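/- Let μ be Lebesgue measure on ℝ², let ℛ be the countable collection of dyadic rectangles of ℝ² (products I × J of dyadic intervals), let C ≥ 1, and let {λ_R}_{R∈ℛ} be a family of non-negative reals satisfying ∑_{R∈ℛ′} λ_R ≤ C · μ(⋃_{R∈ℛ′} R) for every subcollection ℛ′ ⊆ ℛ. Then for each R ∈ ℛ there exists a Borel set E_R ⊆ R such that λ_R ≤ C · μ(E_R) and the sets {E_R}_{R∈ℛ} are pairwise disjoint. -/

import Mathlib

open MeasureTheory Set
open scoped NNReal ENNReal

/-- A dyadic interval of `ℝ` is an interval `[2^{-k} m, 2^{-k}(m+1))` with `k, m ∈ ℤ`. -/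
def IsDyadicInterval (I : Set ℝ) : Prop :=
  ∃ k m : ℤ, I = Set.Ico ((2 : ℝ) ^ (-k) * (m : ℝ)) ((2 : ℝ) ^ (-k) * ((m : ℝ) + 1))

/-- A dyadic rectangle of `ℝ²` is a product `I ×ˢ J` of two dyadic intervals. -/
def IsDyadicRectangle (R : Set (ℝ × ℝ)) : Prop :=
  ∃ I J : Set ℝ, IsDyadicInterval I ∧ IsDyadicInterval J ∧ R = I ×ˢ J

open Classical in
/-- The set function family attached to a family of densities. -/
noncomputable def densFun {X ι : Type*} [MeasurableSpace X] (μ : Measure X) (f : ι → X → ℝ) :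
    ι → Set X → ℝ :=
  fun i A => if MeasurableSet A then ∫ x in A, f i x ∂μ else 0

/-- Admissible densities. -/
structure AdmDens {X ι : Type*} [MeasurableSpace X] (μ : Measure X) (R : ι → Set X)
    (f : ι → X → ℝ) : Prop where
  meas : ∀ i, Measurable (f i)
  int : ∀ i, Integrable (f i) μ
  nonneg : ∀ i, ∀ᵐ x ∂μ, 0 ≤ f i x
  supp : ∀ i, ∀ᵐ x ∂μ, x ∉ R i → f i x = 0
  sum : ∀ F : Finset ι, ∀ᵐ x ∂μ, ∑ i ∈ F, f i x ≤ 1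

/-- Admissible families of finitely additive set functions. -/
structure AdmSet {X ι : Type*} [MeasurableSpace X] (μ : Measure X) (R : ι → Set X)
    (n : ι → Set X → ℝ) : Prop where
  nonneg : ∀ i A, 0 ≤ n i A
  nonmeas : ∀ i A, ¬ MeasurableSet A → n i A = 0
  add : ∀ i A B, MeasurableSet A → MeasurableSet B → Disjoint A B → n i (A ∪ B) = n i A + n i B
  supp : ∀ i, n i (R i)ᶜ = 0
  sum : ∀ F : Finset ι, ∀ A, MeasurableSet A → μ A ≠ ∞ → ∑ i ∈ F, n i A ≤ μ.real A

section
variable {X ι : Type*} [MeasurableSpace X] {μ : Measure X} {R : ι → Set X}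

lemma densFun_mem (hR : ∀ i, MeasurableSet (R i)) {f : ι → X → ℝ} (hf : AdmDens μ R f) :
    AdmSet μ R (densFun μ f) where
  nonneg i A := by
    unfold densFun
    split_ifs
    · exact integral_nonneg_of_ae (ae_restrict_of_ae (hf.nonneg i))
    · exact le_rfl
  nonmeas i A hA := by simp [densFun, hA]
  add i A B hA hB hAB := by
    simp only [densFun, hA, hB, hA.union hB, if_true]
    exact setIntegral_union hAB hB (hf.int i).integrableOn (hf.int i).integrableOn
  supp i := by
    simp only [densFun, (hR i).compl, if_true]
    exact setIntegral_eq_zero_of_ae_eq_zero (hf.supp i)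
  sum F A hA hA' := by
    simp only [densFun, hA, if_true]
    rw [← integral_finsetSum F (fun i _ => (hf.int i).integrableOn)]
    calc ∫ x in A, ∑ i ∈ F, f i x ∂μ ≤ ∫ x in A, (1 : ℝ) ∂μ := by
          apply integral_mono_ae
          · exact integrable_finsetSum _ (fun i _ => (hf.int i).integrableOn)
          · exact integrableOn_const hA'
          · exact ae_restrict_of_ae (hf.sum F)
      _ = μ.real A := by simp

lemma AdmSet.mono {n : ι → Set X → ℝ} (hn : AdmSet μ R n) (i : ι) {A B : Set X}
    (hA : MeasurableSet A) (hB : MeasurableSet B) (h : A ⊆ B) : n i A ≤ n i B := by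
  have := hn.add i A (B \ A) hA (hB.diff hA) disjoint_sdiff_right
  rw [Set.union_sdiff_cancel h] at this
  linarith [hn.nonneg i (B \ A)]

lemma AdmSet.le (hR : ∀ i, MeasurableSet (R i)) (hRf : ∀ i, μ (R i) ≠ ∞)
    {n : ι → Set X → ℝ} (hn : AdmSet μ R n) (i : ι) {A : Set X}
    (hA : MeasurableSet A) : n i A ≤ μ.real (A ∩ R i) := by
  have h1 := hn.add i (A ∩ R i) (A \ R i) (hA.inter (hR i)) (hA.diff (hR i))
    disjoint_inf_sdiff
  rw [Set.inter_union_sdiff] at h1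
  have h2 : n i (A \ R i) ≤ n i (R i)ᶜ := hn.mono i (hA.diff (hR i)) (hR i).compl (fun x hx => hx.2)
  have h3 := hn.sum {i} (A ∩ R i) (hA.inter (hR i)) (measure_ne_top_of_subset inter_subset_right (hRf i))
  simp only [Finset.sum_singleton] at h3
  linarith [hn.supp i]

lemma AdmSet.empty {n : ι → Set X → ℝ} (hn : AdmSet μ R n) (i : ι) : n i ∅ = 0 := by
  have := hn.add i ∅ ∅ .empty .empty (by simp)
  simp only [Set.union_empty] at this
  linarith

lemma AdmSet.finset {n : ι → Set X → ℝ} (hn : AdmSet μ R n) (i : ι) {A : ℕ → Set X}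
    (hA : ∀ k, MeasurableSet (A k)) (hd : Pairwise (Function.onFun Disjoint A)) (N : ℕ) :
    ∑ k ∈ Finset.range N, n i (A k) = n i (⋃ k ∈ Finset.range N, A k) := by
  induction N with
  | zero => simp [hn.empty]
  | succ N ih =>
    rw [Finset.sum_range_succ, ih, Finset.range_add_one, Finset.set_biUnion_insert, Set.union_comm,
      hn.add _ _ _ (Finset.measurableSet_biUnion _ fun k _ => hA k) (hA N)]
    rw [Set.disjoint_iUnion₂_left]
    intro k hk
    exact hd (by simp at hk; omega)

/-- The signed measure attached to an admissible set function. -/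
noncomputable def AdmSet.vm (hR : ∀ i, MeasurableSet (R i)) (hRf : ∀ i, μ (R i) ≠ ∞)
    {n : ι → Set X → ℝ} (hn : AdmSet μ R n) (i : ι) : SignedMeasure X where
  measureOf' := n i
  empty' := hn.empty i
  not_measurable' A hA := hn.nonmeas i A hA
  m_iUnion' A hA hd := by
    rw [hasSum_iff_tendsto_nat_of_nonneg (fun k => hn.nonneg i _)]
    simp_rw [hn.finset i hA hd]
    have hmU : ∀ N : ℕ, MeasurableSet (⋃ k ∈ Finset.range N, A k) :=
      fun N => Finset.measurableSet_biUnion _ fun k _ => hA k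
    have hU : MeasurableSet (⋃ k, A k) := MeasurableSet.iUnion hA
    have hsub : ∀ N : ℕ, (⋃ k ∈ Finset.range N, A k) ⊆ ⋃ k, A k :=
      fun N => iUnion₂_subset fun k _ => subset_iUnion A k
    have key : ∀ N : ℕ, n i (⋃ k, A k) - μ.real (((⋃ k, A k) \ (⋃ k ∈ Finset.range N, A k)) ∩ R i)
        ≤ n i (⋃ k ∈ Finset.range N, A k) := by
      intro N
      have h1 := hn.add i _ _ (hmU N) (hU.diff (hmU N)) disjoint_sdiff_right
      rw [Set.union_sdiff_cancel (hsub N)] at h1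
      have h2 := hn.le hR hRf i (hU.diff (hmU N))
      linarith
    have hlim : Filter.Tendsto (fun N : ℕ => μ (((⋃ k, A k) \ (⋃ k ∈ Finset.range N, A k)) ∩ R i))
        Filter.atTop (nhds 0) := by
      have := tendsto_measure_iInter_atTop (μ := μ)
        (s := fun N : ℕ => ((⋃ k, A k) \ (⋃ k ∈ Finset.range N, A k)) ∩ R i)
        (fun N => ((hU.diff (hmU N)).inter (hR i)).nullMeasurableSet)
        (by
          intro N M hNM
          apply inter_subset_inter_left
          apply sdiff_subset_sdiff_right
          exact biUnion_subset_biUnion_left (by simpa using hNM))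
        ⟨0, measure_ne_top_of_subset inter_subset_right (hRf i)⟩
      rw [show (⋂ N : ℕ, ((⋃ k, A k) \ (⋃ k ∈ Finset.range N, A k)) ∩ R i) = ∅ from ?_,
        measure_empty] at this
      · exact this
      · ext x
        simp only [mem_iInter, mem_inter_iff, mem_sdiff, mem_iUnion, mem_empty_iff_false, iff_false]
        intro h
        obtain ⟨⟨⟨k, hk⟩, -⟩, -⟩ := h 0
        exact (h (k+1)).1.2 ⟨k, by simp, hk⟩
    have hlim2 := (ENNReal.tendsto_toReal (ENNReal.zero_ne_top)).comp hlim
    refine tendsto_of_tendsto_of_tendsto_of_le_of_le ?_ tendsto_const_nhds key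
      (fun N => hn.mono i (hmU N) hU (hsub N))
    simpa [measureReal_def] using tendsto_const_nhds.sub hlim2

lemma AdmSet.exists_dens [SigmaFinite μ] (hR : ∀ i, MeasurableSet (R i))
    (hRf : ∀ i, μ (R i) ≠ ∞)
    {n : ι → Set X → ℝ} (hn : AdmSet μ R n) : ∃ f, AdmDens μ R f ∧ n = densFun μ f := by
  have hac : ∀ i, (hn.vm hR hRf i) ≪ᵥ μ.toENNRealVectorMeasure := by
    intro i
    apply VectorMeasure.AbsolutelyContinuous.mk
    intro A hA h0
    rw [Measure.toENNRealVectorMeasure_apply_measurable hA] at h0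
    have h1 := hn.le hR hRf i hA
    have h2 : μ.real (A ∩ R i) = 0 := by
      rw [measureReal_def, measure_mono_null inter_subset_left h0]; rfl
    exact le_antisymm (h1.trans h2.le) (hn.nonneg i A)
  let f : ι → X → ℝ := fun i => (hn.vm hR hRf i).rnDeriv μ
  have hfi : ∀ i, Integrable (f i) μ := fun i => SignedMeasure.integrable_rnDeriv _ _
  have hfA : ∀ i A, MeasurableSet A → n i A = ∫ x in A, f i x ∂μ := by
    intro i A hA
    have h := (SignedMeasure.absolutelyContinuous_iff_withDensityᵥ_rnDeriv_eq _ μ).1 (hac i)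
    have h2 := congrArg (fun v : SignedMeasure X => v A) h
    rw [withDensityᵥ_apply (SignedMeasure.integrable_rnDeriv _ _) hA] at h2
    exact h2.symm
  have hnn : ∀ i, ∀ᵐ x ∂μ, 0 ≤ f i x := by
    intro i
    exact ae_nonneg_of_forall_setIntegral_nonneg (hfi i)
      (fun s hs _ => by rw [← hfA i s hs]; exact hn.nonneg i s)
  refine ⟨f, ⟨fun i => SignedMeasure.measurable_rnDeriv _ _, hfi, hnn, ?_, ?_⟩, ?_⟩
  · intro i
    have h := hfA i _ (hR i).compl
    rw [hn.supp i] at h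
    have h2 := (integral_eq_zero_iff_of_nonneg_ae (ae_restrict_of_ae (hnn i)) (hfi i).integrableOn).1 h.symm
    exact (ae_restrict_iff' (hR i).compl).1 h2
  · intro F
    have : 0 ≤ᵐ[μ] fun x => 1 - ∑ i ∈ F, f i x := by
      apply ae_nonneg_of_forall_setIntegral_nonneg_of_sigmaFinite
      · intro s hs hs'
        exact (integrableOn_const hs'.ne).sub (integrable_finsetSum _ (fun i _ => (hfi i).integrableOn))
      · intro s hs hs'
        have hi1 : Integrable (fun _ : X => (1 : ℝ)) (μ.restrict s) := integrableOn_const hs'.ne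
        rw [integral_sub hi1
          (integrable_finsetSum _ (fun i _ => (hfi i).integrableOn)),
          integral_finsetSum F (fun i _ => (hfi i).integrableOn)]
        have := hn.sum F s hs hs'.ne
        simp_rw [hfA _ s hs] at this
        simpa using this
    filter_upwards [this] with x hx
    simp only [Pi.zero_apply] at hx
    linarith
  · funext i A
    by_cases hA : MeasurableSet A
    · simp [densFun, hA, hfA i A hA]
    · simp [densFun, hA, hn.nonmeas i A hA]

lemma isCompact_admSet (hR : ∀ i, MeasurableSet (R i)) (hRf : ∀ i, μ (R i) ≠ ∞) :
    IsCompact {n : ι → Set X → ℝ | AdmSet μ R n} := by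
  have hc : IsCompact (Set.pi univ fun i : ι => Set.pi univ fun A : Set X =>
      Set.Icc (0 : ℝ) (μ.real (A ∩ R i))) :=
    isCompact_univ_pi fun i => isCompact_univ_pi fun A => isCompact_Icc
  refine hc.of_isClosed_subset ?_ ?_
  · have : {n : ι → Set X → ℝ | AdmSet μ R n} =
        {n | ∀ i A, 0 ≤ n i A} ∩ {n | ∀ i A, ¬ MeasurableSet A → n i A = 0} ∩
        {n | ∀ i A B, MeasurableSet A → MeasurableSet B → Disjoint A B →
          n i (A ∪ B) = n i A + n i B} ∩ {n | ∀ i, n i (R i)ᶜ = 0} ∩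
        {n | ∀ F : Finset ι, ∀ A, MeasurableSet A → μ A ≠ ∞ → ∑ i ∈ F, n i A ≤ μ.real A} := by
      ext n
      constructor
      · rintro ⟨h1, h2, h3, h4, h5⟩
        exact ⟨⟨⟨⟨h1, h2⟩, h3⟩, h4⟩, h5⟩
      · rintro ⟨⟨⟨⟨h1, h2⟩, h3⟩, h4⟩, h5⟩
        exact ⟨h1, h2, h3, h4, h5⟩
    rw [this]
    simp only [ofPred_forall]
    refine (((IsClosed.inter ?_ ?_).inter ?_).inter ?_).inter ?_
    · exact isClosed_iInter fun i => isClosed_iInter fun A => isClosed_le (by fun_prop) (by fun_prop)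
    · exact isClosed_iInter fun i => isClosed_iInter fun A => isClosed_iInter fun _ =>
        isClosed_eq (by fun_prop) (by fun_prop)
    · exact isClosed_iInter fun i => isClosed_iInter fun A => isClosed_iInter fun B =>
        isClosed_iInter fun _ => isClosed_iInter fun _ => isClosed_iInter fun _ =>
        isClosed_eq (by fun_prop) (by fun_prop)
    · exact isClosed_iInter fun i => isClosed_eq (by fun_prop) (by fun_prop)
    · exact isClosed_iInter fun i => isClosed_iInter fun A => isClosed_iInter fun _ =>
        isClosed_iInter fun _ => isClosed_le (by fun_prop) (by fun_prop)
  · intro n hn i _ A _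
    by_cases hA : MeasurableSet A
    · exact ⟨hn.nonneg i A, hn.le hR hRf i hA⟩
    · simp only [hn.nonmeas i A hA]
      exact ⟨le_rfl, measureReal_nonneg⟩

lemma convex_admSet : Convex ℝ {n : ι → Set X → ℝ | AdmSet μ R n} := by
  intro n hn m hm s t hs ht hst
  constructor
  · intro i A
    have := hn.nonneg i A
    have := hm.nonneg i A
    simp only [Pi.add_apply, Pi.smul_apply, smul_eq_mul]
    positivity
  · intro i A hA
    simp [hn.nonmeas i A hA, hm.nonmeas i A hA]
  · intro i A B hA hB hAB
    simp only [Pi.add_apply, Pi.smul_apply, smul_eq_mul, hn.add i A B hA hB hAB,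
      hm.add i A B hA hB hAB]
    ring
  · intro i
    simp [hn.supp i, hm.supp i]
  · intro F A hA hA'
    simp only [Pi.add_apply, Pi.smul_apply, smul_eq_mul, Finset.sum_add_distrib, ← Finset.mul_sum]
    have h1 := mul_le_mul_of_nonneg_left (hn.sum F A hA hA') hs
    have h2 := mul_le_mul_of_nonneg_left (hm.sum F A hA hA') ht
    have h3 : s * μ.real A + t * μ.real A = μ.real A := by rw [← add_mul, hst, one_mul]
    linarith

lemma greedy_select (hR : ∀ i, MeasurableSet (R i)) (hRf : ∀ i, μ (R i) ≠ ∞) (a : ι → ℝ)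
    (ha : ∀ s : Finset ι, ∑ i ∈ s, a i ≤ μ.real (⋃ i ∈ s, R i)) (w : ι → ℝ) (s : Finset ι) :
    ∃ E : ι → Set X, (∀ i, MeasurableSet (E i)) ∧ (∀ i, E i ⊆ R i) ∧ (∀ i, i ∉ s → E i = ∅) ∧
      Pairwise (Function.onFun Disjoint E) ∧ (⋃ i ∈ s, E i) = (⋃ i ∈ s, R i) ∧
      ∀ c, (∀ i ∈ s, c ≤ w i) → 0 ≤ ∑ i ∈ s, (w i - c) * (μ.real (E i) - a i) := by
  classical
  induction s using Finset.induction_on_min_value w with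
  | empty => exact ⟨fun _ => ∅, by simp, by simp, by simp, fun i j _ => by simp [Function.onFun], by simp, by simp⟩
  | insert j s hj hmin ih =>
    obtain ⟨E, hm, hsub, hemp, hd, hU, hc⟩ := ih
    have hmU : MeasurableSet (⋃ i ∈ s, R i) := Finset.measurableSet_biUnion _ fun k _ => hR k
    let E' : ι → Set X := Function.update E j (R j \ ⋃ i ∈ s, R i)
    have hE'j : E' j = R j \ ⋃ i ∈ s, R i := by simp [E']
    have hE'n : ∀ i, i ≠ j → E' i = E i := fun i hi => by simp [E', hi]
    have hEs : ∀ i, E i ⊆ ⋃ i ∈ s, R i := by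
      intro i
      by_cases his : i ∈ s
      · exact (hsub i).trans (subset_biUnion_of_mem (u := R) his)
      · simp [hemp i his]
    have hE'm : ∀ i, MeasurableSet (E' i) := by
      intro i
      by_cases hi : i = j
      · subst hi; rw [hE'j]; exact (hR i).diff hmU
      · rw [hE'n i hi]; exact hm i
    have hE'sub : ∀ i, E' i ⊆ R i := by
      intro i
      by_cases hi : i = j
      · subst hi; rw [hE'j]; exact fun x hx => hx.1
      · rw [hE'n i hi]; exact hsub i
    have hE'd : Pairwise (Function.onFun Disjoint E') := by
      intro i k hik
      simp only [Function.onFun]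
      by_cases hi : i = j
      · subst hi
        rw [hE'j, hE'n k hik.symm]
        exact disjoint_sdiff_left.mono_right (hEs k)
      · by_cases hk : k = j
        · subst hk
          rw [hE'j, hE'n i hik]
          exact disjoint_sdiff_right.mono_left (hEs i)
        · rw [hE'n i hi, hE'n k hk]
          exact hd hik
    have hsame : (⋃ i ∈ s, E' i) = ⋃ i ∈ s, E i := by
      apply iUnion₂_congr
      intro i hi
      exact hE'n i (fun h => hj (h ▸ hi))
    have hE'U : (⋃ i ∈ insert j s, E' i) = ⋃ i ∈ insert j s, R i := by
      rw [Finset.set_biUnion_insert, Finset.set_biUnion_insert, hsame, hU, hE'j,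
        Set.sdiff_union_self]
    refine ⟨E', hE'm, hE'sub, ?_, hE'd, hE'U, ?_⟩
    · intro i hi
      simp only [Finset.mem_insert, not_or] at hi
      rw [hE'n i hi.1, hemp i hi.2]
    · intro c hcw
      have htot : 0 ≤ ∑ i ∈ insert j s, (μ.real (E' i) - a i) := by
        rw [Finset.sum_sub_distrib, ← measureReal_biUnion_finset (fun i _ k _ hik => hE'd hik)
          (fun i _ => hE'm i) (fun i _ => measure_ne_top_of_subset (hE'sub i) (hRf i)), hE'U]
        linarith [ha (insert j s)]
      have hcj := hcw j (Finset.mem_insert_self _ _)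
      have hprev := hc (w j) hmin
      have hs' : ∑ i ∈ s, (w i - w j) * (μ.real (E i) - a i)
          = ∑ i ∈ insert j s, (w i - w j) * (μ.real (E' i) - a i) := by
        rw [Finset.sum_insert hj, sub_self, zero_mul, zero_add]
        refine Finset.sum_congr rfl fun i hi => ?_
        rw [hE'n i (fun h => hj (h ▸ hi))]
      rw [hs'] at hprev
      have : ∑ i ∈ insert j s, (w i - c) * (μ.real (E' i) - a i)
          = ∑ i ∈ insert j s, (w i - w j) * (μ.real (E' i) - a i)
            + (w j - c) * ∑ i ∈ insert j s, (μ.real (E' i) - a i) := by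
        rw [Finset.mul_sum, ← Finset.sum_add_distrib]
        refine Finset.sum_congr rfl fun i _ => ?_
        ring
      rw [this]
      have := mul_nonneg (sub_nonneg.2 hcj) htot
      linarith

lemma admDens_indicator (hRf : ∀ i, μ (R i) ≠ ∞) {E : ι → Set X} (hm : ∀ i, MeasurableSet (E i))
    (hsub : ∀ i, E i ⊆ R i) (hd : Pairwise (Function.onFun Disjoint E)) :
    AdmDens μ R (fun i => (E i).indicator (fun _ => (1 : ℝ))) where
  meas i := measurable_const.indicator (hm i)
  int i := (integrable_indicator_iff (hm i)).2
    (integrableOn_const (measure_ne_top_of_subset (hsub i) (hRf i)))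
  nonneg i := Filter.Eventually.of_forall fun x => indicator_nonneg (fun _ _ => zero_le_one) x
  supp i := Filter.Eventually.of_forall fun x hx => indicator_of_notMem (fun h => hx (hsub i h)) _
  sum F := Filter.Eventually.of_forall fun x => by
    by_cases h : ∃ i ∈ F, x ∈ E i
    · obtain ⟨i, hi, hx⟩ := h
      rw [Finset.sum_eq_single i]
      · simp [hx]
      · intro k _ hk
        exact indicator_of_notMem (fun h => (Set.disjoint_left.1 (hd hk) h hx)) _
      · exact fun h => absurd hi h
    · push Not at h
      rw [Finset.sum_eq_zero]
      · exact zero_le_one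
      · intro i hi
        exact indicator_of_notMem (h i hi) _

lemma finite_exists (hR : ∀ i, MeasurableSet (R i)) (hRf : ∀ i, μ (R i) ≠ ∞) (a : ι → ℝ)
    (ha : ∀ s : Finset ι, ∑ i ∈ s, a i ≤ μ.real (⋃ i ∈ s, R i)) (s : Finset ι) :
    ∃ n, AdmSet μ R n ∧ ∀ i ∈ s, a i ≤ n i univ := by
  classical
  by_contra hcon
  push Not at hcon
  let T : (ι → Set X → ℝ) →ₗ[ℝ] (s → ℝ) :=
    { toFun := fun n i => n i univ
      map_add' := fun _ _ => rfl
      map_smul' := fun _ _ => rfl }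
  have hT : Continuous T := by
    change Continuous (fun (n : ι → Set X → ℝ) (i : s) => n i univ)
    fun_prop
  let a' : s → ℝ := fun i => a i
  obtain ⟨f, u, v, h1, huv, h2⟩ := geometric_hahn_banach_compact_closed
    (s := T '' {n | AdmSet μ R n}) (t := Set.Ici a')
    (convex_admSet.linear_image T) ((isCompact_admSet hR hRf).image hT)
    (convex_Ici a') isClosed_Ici (by
      rw [Set.disjoint_left]
      rintro _ ⟨n, hn, rfl⟩ hge
      obtain ⟨i, hi, hlt⟩ := hcon n hn
      exact absurd (hge ⟨i, hi⟩) (not_le.2 hlt))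
  let w : ι → ℝ := fun i => if h : i ∈ s then f (Pi.single ⟨i, h⟩ 1) else 0
  have hf : ∀ x : ι → ℝ, f (fun i : s => x i) = ∑ i ∈ s, w i * x i := by
    intro x
    have := LinearMap.pi_apply_eq_sum_univ (f : (s → ℝ) →ₗ[ℝ] ℝ) (fun i : s => x i)
    simp only [ContinuousLinearMap.coe_coe] at this
    rw [this, ← Finset.sum_coe_sort s]
    refine Finset.sum_congr rfl fun i _ => ?_
    simp only [w, i.2, dif_pos, smul_eq_mul]
    rw [mul_comm]
    congr 2
    ext j
    simp [Pi.single_apply, eq_comm]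
  have hw : ∀ i ∈ s, 0 ≤ w i := by
    intro i hi
    by_contra hneg
    push Not at hneg
    have h0 := h2 a' (Set.mem_Ici.2 le_rfl)
    have hwi : f (Pi.single ⟨i, hi⟩ 1) = w i := by simp [w, hi]
    have h3 := h2 (a' + ((f a' - v) / (- w i)) • Pi.single ⟨i, hi⟩ 1) (by
      rw [Set.mem_Ici]
      apply le_add_of_nonneg_right
      apply smul_nonneg
      · apply div_nonneg <;> linarith
      · intro j; by_cases hj : j = ⟨i, hi⟩
        · subst hj; simp
        · simp [hj])
    rw [map_add, map_smul, hwi, smul_eq_mul] at h3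
    have : (f a' - v) / (- w i) * w i = -(f a' - v) := by
      rw [div_neg, neg_mul, div_mul_cancel₀ _ hneg.ne]
    rw [this] at h3
    linarith
  obtain ⟨E, hm, hsub, -, hd, -, hc⟩ := greedy_select hR hRf a ha w s
  have hadm := densFun_mem hR (admDens_indicator (μ := μ) hRf hm hsub hd)
  have h3 := h1 _ ⟨_, hadm, rfl⟩
  have h4 := h2 a' (Set.mem_Ici.2 le_rfl)
  have h5 := hc 0 hw
  have h6 : f a' = ∑ i ∈ s, w i * a i := hf a
  have h7 : f (T (densFun μ fun i => (E i).indicator (fun _ => (1 : ℝ))))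
      = ∑ i ∈ s, w i * μ.real (E i) := by
    rw [← hf]
    congr 1
    ext i
    simp [T, densFun, integral_indicator (hm _)]
  rw [h7] at h3
  rw [h6] at h4
  simp only [sub_zero, mul_sub, Finset.sum_sub_distrib] at h5
  linarith

lemma exists_extreme (hR : ∀ i, MeasurableSet (R i)) (hRf : ∀ i, μ (R i) ≠ ∞) (a : ι → ℝ)
    (ha : ∀ s : Finset ι, ∑ i ∈ s, a i ≤ μ.real (⋃ i ∈ s, R i)) :
    ({n : ι → Set X → ℝ | AdmSet μ R n ∧ ∀ i, a i ≤ n i univ}.extremePoints ℝ).Nonempty := by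
  have hcl : ∀ i, IsClosed {n : ι → Set X → ℝ | a i ≤ n i univ} := fun i =>
    isClosed_le (by fun_prop) (by fun_prop)
  have heq : {n : ι → Set X → ℝ | AdmSet μ R n ∧ ∀ i, a i ≤ n i univ}
      = {n | AdmSet μ R n} ∩ ⋂ i, {n | a i ≤ n i univ} := by
    ext n; simp
  rw [heq]
  apply IsCompact.extremePoints_nonempty
  · exact (isCompact_admSet hR hRf).inter_right (isClosed_iInter hcl)
  · apply (isCompact_admSet hR hRf).inter_iInter_nonempty _ hcl
    intro s
    obtain ⟨n, hn, h⟩ := finite_exists hR hRf a ha s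
    exact ⟨n, hn, by simpa using h⟩

lemma densFun_add {f : ι → X → ℝ} {h : X → ℝ} (hf : ∀ i, Integrable (f i) μ)
    (hh : Integrable h μ) (p : ι → ℝ) (i : ι) {A : Set X} (hA : MeasurableSet A) :
    densFun μ (fun i x => f i x + p i * h x) i A = densFun μ f i A + p i * ∫ x in A, h x ∂μ := by
  simp only [densFun, hA, if_true]
  rw [integral_add (hf i).integrableOn (hh.const_mul _).integrableOn, integral_const_mul]

lemma extreme_core {a : ι → ℝ} (hR : ∀ i, MeasurableSet (R i))
    (hsplit : ∀ B, MeasurableSet B → μ B ≠ 0 →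
      ∃ B₁ ⊆ B, MeasurableSet B₁ ∧ μ B₁ ≠ 0 ∧ μ (B \ B₁) ≠ 0)
    {f : ι → X → ℝ} (hf : AdmDens μ R f)
    (hext : densFun μ f ∈
      {n : ι → Set X → ℝ | AdmSet μ R n ∧ ∀ i, a i ≤ n i univ}.extremePoints ℝ)
    (g : X → ℝ) (hg : Measurable g) (hgi : Integrable g μ) (p : ι → ℝ) (j : ι) (hp : p j ≠ 0)
    (hpert : ∀ h : X → ℝ, Measurable h → Integrable h μ → (∀ x, |h x| ≤ |g x|) →
      AdmDens μ R (fun i x => f i x + p i * h x)) : ∀ᵐ x ∂μ, g x = 0 := by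
  by_contra hne
  have hB : MeasurableSet {x | g x ≠ 0} := (hg (measurableSet_singleton 0)).compl
  obtain ⟨B₁, hsub, hB₁, h1, h2⟩ := hsplit {x | g x ≠ 0} hB (fun h => hne (by rwa [ae_iff]))
  set B₂ := {x | g x ≠ 0} \ B₁ with hB₂d
  have hB₂ : MeasurableSet B₂ := hB.diff hB₁
  have hpos : ∀ D : Set X, MeasurableSet D → D ⊆ {x | g x ≠ 0} → μ D ≠ 0 →
      0 < ∫ x in D, |g x| ∂μ := by
    intro D hD hDs hD0
    rw [setIntegral_pos_iff_support_of_nonneg_ae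
      (Filter.Eventually.of_forall fun x => abs_nonneg _) hgi.abs.integrableOn]
    rw [pos_iff_ne_zero, Set.inter_eq_right.2 (fun x hx => by simpa using hDs hx)]
    exact hD0
  have hm1 := hpos B₁ hB₁ hsub h1
  have hm2 := hpos B₂ hB₂ (fun x hx => hx.1) h2
  set m₁ := ∫ x in B₁, |g x| ∂μ
  set m₂ := ∫ x in B₂, |g x| ∂μ
  let c₁ := m₂ / (m₁ + m₂)
  let c₂ := m₁ / (m₁ + m₂)
  have hc₁ : 0 < c₁ := by positivity
  have hc₂ : 0 < c₂ := by positivity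
  have hc₁1 : c₁ ≤ 1 := by rw [div_le_one (by positivity)]; linarith
  have hc₂1 : c₂ ≤ 1 := by rw [div_le_one (by positivity)]; linarith
  let h : X → ℝ := fun x => B₁.indicator (fun x => c₁ * |g x|) x - B₂.indicator (fun x => c₂ * |g x|) x
  have hi1 : Integrable (B₁.indicator (fun x => c₁ * |g x|)) μ := (hgi.abs.const_mul c₁).indicator hB₁
  have hi2 : Integrable (B₂.indicator (fun x => c₂ * |g x|)) μ := (hgi.abs.const_mul c₂).indicator hB₂
  have hhi : Integrable h μ := hi1.sub hi2
  have habs : Measurable fun x => |g x| := hg.abs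
  have hhm : Measurable h :=
    ((habs.const_mul c₁).indicator hB₁).sub ((habs.const_mul c₂).indicator hB₂)
  have hle : ∀ x, |h x| ≤ |g x| := by
    intro x
    have hgx := abs_nonneg (g x)
    simp only [h]
    by_cases hx1 : x ∈ B₁
    · have hx2 : x ∉ B₂ := fun hx => hx.2 hx1
      rw [indicator_of_mem hx1, indicator_of_notMem hx2, sub_zero, abs_of_nonneg (by positivity)]
      nlinarith
    · rw [indicator_of_notMem hx1]
      by_cases hx2 : x ∈ B₂
      · rw [indicator_of_mem hx2, zero_sub, abs_neg, abs_of_nonneg (by positivity)]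
        nlinarith
      · rw [indicator_of_notMem hx2]; simp
  have hint : ∫ x, h x ∂μ = 0 := by
    simp only [h]
    rw [integral_sub hi1 hi2, integral_indicator hB₁, integral_indicator hB₂, integral_const_mul,
      integral_const_mul]
    change c₁ * m₁ - c₂ * m₂ = 0
    simp only [c₁, c₂]
    ring
  have hint1 : ∫ x in B₁, h x ∂μ = c₁ * m₁ := by
    rw [← integral_const_mul]
    refine setIntegral_congr_fun hB₁ fun x hx => ?_
    have hx2 : x ∉ B₂ := fun hx' => hx'.2 hx
    simp only [h]
    rw [indicator_of_mem hx, indicator_of_notMem hx2, sub_zero]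
  have hP := hpert h hhm hhi hle
  have hN := hpert (fun x => - h x) hhm.neg hhi.neg (fun x => by rw [abs_neg]; exact hle x)
  have hPmem : densFun μ (fun i x => f i x + p i * h x) ∈
      {n : ι → Set X → ℝ | AdmSet μ R n ∧ ∀ i, a i ≤ n i univ} := by
    refine ⟨densFun_mem hR hP, fun i => ?_⟩
    rw [densFun_add hf.int hhi p i .univ, setIntegral_univ, hint, mul_zero, add_zero]
    exact hext.1.2 i
  have hNmem : densFun μ (fun i x => f i x + p i * (- h x)) ∈
      {n : ι → Set X → ℝ | AdmSet μ R n ∧ ∀ i, a i ≤ n i univ} := by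
    refine ⟨densFun_mem hR hN, fun i => ?_⟩
    rw [densFun_add (h := fun x => - h x) hf.int hhi.neg p i .univ, setIntegral_univ, integral_neg, hint, neg_zero,
      mul_zero, add_zero]
    exact hext.1.2 i
  have hseg : densFun μ f ∈ openSegment ℝ (densFun μ (fun i x => f i x + p i * h x))
      (densFun μ (fun i x => f i x + p i * (- h x))) := by
    refine ⟨1/2, 1/2, by norm_num, by norm_num, by norm_num, ?_⟩
    funext i A
    by_cases hA : MeasurableSet A
    · simp only [Pi.add_apply, Pi.smul_apply, smul_eq_mul]
      rw [densFun_add hf.int hhi p i hA, densFun_add (h := fun x => - h x) hf.int hhi.neg p i hA, integral_neg]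
      ring
    · simp [densFun, hA]
  have heq := hext.2 hPmem hNmem hseg
  have h3 := congrFun (congrFun heq j) B₁
  rw [densFun_add hf.int hhi p j hB₁, hint1] at h3
  have h4 : p j * (c₁ * m₁) = 0 := by linarith
  have : c₁ * m₁ ≠ 0 := by positivity
  exact mul_ne_zero hp this h4

lemma extreme_disjoint [Countable ι] {a : ι → ℝ} (hR : ∀ i, MeasurableSet (R i))
    (hsplit : ∀ B, MeasurableSet B → μ B ≠ 0 →
      ∃ B₁ ⊆ B, MeasurableSet B₁ ∧ μ B₁ ≠ 0 ∧ μ (B \ B₁) ≠ 0)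
    {f : ι → X → ℝ} (hf : AdmDens μ R f)
    (hext : densFun μ f ∈
      {n : ι → Set X → ℝ | AdmSet μ R n ∧ ∀ i, a i ≤ n i univ}.extremePoints ℝ)
    (i j : ι) (hij : i ≠ j) : ∀ᵐ x ∂μ, min (f i x) (f j x) = 0 := by
  classical
  let p : ι → ℝ := fun k => if k = i then 1 else if k = j then -1 else 0
  have hpi : p i = 1 := by simp [p]
  have hpj : p j = -1 := by simp [p, hij.symm]
  have hpk : ∀ k, k ≠ i → k ≠ j → p k = 0 := fun k h1 h2 => by simp [p, h1, h2]
  refine extreme_core hR hsplit hf hext (fun x => min (f i x) (f j x))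
    ((hf.meas i).min (hf.meas j)) ((hf.int i).inf (hf.int j)) p i (by simp [hpi]) ?_
  intro h hm hi hle
  have hnn : ∀ᵐ x ∂μ, ∀ k, 0 ≤ f k x := ae_all_iff.2 hf.nonneg
  have hbd : ∀ᵐ x ∂μ, |h x| ≤ f i x ∧ |h x| ≤ f j x := by
    filter_upwards [hnn] with x hx
    have := hle x
    rw [abs_of_nonneg (le_min (hx i) (hx j))] at this
    exact le_min_iff.1 this
  have hnn' : ∀ᵐ x ∂μ, ∀ k, 0 ≤ f k x + p k * h x := by
    filter_upwards [hnn, hbd] with x hx hb k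
    have h1 := abs_le.1 hb.1
    have h2 := abs_le.1 hb.2
    by_cases hki : k = i
    · subst hki; rw [hpi]; linarith
    · by_cases hkj : k = j
      · subst hkj; rw [hpj]; linarith
      · rw [hpk k hki hkj]; linarith [hx k]
  refine ⟨fun k => (hf.meas k).add (hm.const_mul _), fun k => (hf.int k).add (hi.const_mul _),
    fun k => hnn'.mono fun x hx => hx k, ?_, ?_⟩
  · intro k
    filter_upwards [hf.supp k, hbd] with x hx hb hxR
    have h0 := hx hxR
    by_cases hki : k = i
    · subst hki
      rw [h0] at hb ⊢
      simp [abs_nonpos_iff.1 hb.1]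
    · by_cases hkj : k = j
      · subst hkj
        rw [h0] at hb ⊢
        simp [abs_nonpos_iff.1 hb.2]
      · rw [hpk k hki hkj, h0]; simp
  · intro F
    filter_upwards [hnn', hf.sum (insert i (insert j F))] with x hx hs
    calc ∑ k ∈ F, (f k x + p k * h x)
        ≤ ∑ k ∈ insert i (insert j F), (f k x + p k * h x) :=
          Finset.sum_le_sum_of_subset_of_nonneg
            ((Finset.subset_insert _ _).trans (Finset.subset_insert _ _)) (fun k _ _ => hx k)
      _ = ∑ k ∈ insert i (insert j F), f k x + (∑ k ∈ insert i (insert j F), p k) * h x := by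
          rw [Finset.sum_add_distrib, Finset.sum_mul]
      _ ≤ 1 := by
          have : ∑ k ∈ insert i (insert j F), p k = 0 := by
            rw [← Finset.sum_subset (s₁ := {i, j})]
            · rw [Finset.sum_pair hij, hpi, hpj]; norm_num
            · intro k hk
              simp only [Finset.mem_insert, Finset.mem_singleton] at hk ⊢
              tauto
            · intro k _ hk
              simp only [Finset.mem_insert, Finset.mem_singleton, not_or] at hk
              exact hpk k hk.1 hk.2
          rw [this]; linarith

lemma extreme_zero_one [Countable ι] {a : ι → ℝ} (hR : ∀ i, MeasurableSet (R i))
    (hsplit : ∀ B, MeasurableSet B → μ B ≠ 0 →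
      ∃ B₁ ⊆ B, MeasurableSet B₁ ∧ μ B₁ ≠ 0 ∧ μ (B \ B₁) ≠ 0)
    {f : ι → X → ℝ} (hf : AdmDens μ R f)
    (hext : densFun μ f ∈
      {n : ι → Set X → ℝ | AdmSet μ R n ∧ ∀ i, a i ≤ n i univ}.extremePoints ℝ)
    (i : ι) : ∀ᵐ x ∂μ, min (f i x) (1 - f i x) = 0 := by
  classical
  let p : ι → ℝ := fun k => if k = i then 1 else 0
  have hpi : p i = 1 := by simp [p]
  have hpk : ∀ k, k ≠ i → p k = 0 := fun k h1 => by simp [p, h1]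
  have hdis : ∀ᵐ x ∂μ, ∀ k, i ≠ k → min (f i x) (f k x) = 0 := by
    rw [ae_all_iff]
    intro k
    by_cases hk : i = k
    · exact Filter.Eventually.of_forall fun x h => absurd hk h
    · exact (extreme_disjoint hR hsplit hf hext i k hk).mono fun x hx _ => hx
  have hnn : ∀ᵐ x ∂μ, ∀ k, 0 ≤ f k x := ae_all_iff.2 hf.nonneg
  have hle1 : ∀ᵐ x ∂μ, f i x ≤ 1 := by simpa using hf.sum {i}
  have hgm : Measurable fun x => min (f i x) (1 - f i x) :=
    (hf.meas i).min (measurable_const.sub (hf.meas i))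
  refine extreme_core hR hsplit hf hext (fun x => min (f i x) (1 - f i x)) hgm
    ((hf.int i).mono hgm.aestronglyMeasurable ?_) p i (by simp [hpi]) ?_
  · filter_upwards [hnn, hle1] with x hx h1
    rw [Real.norm_eq_abs, Real.norm_eq_abs, abs_of_nonneg (hx i),
      abs_of_nonneg (le_min (hx i) (by linarith))]
    exact min_le_left _ _
  intro h hm hi hle
  have hbd : ∀ᵐ x ∂μ, |h x| ≤ f i x ∧ |h x| ≤ 1 - f i x := by
    filter_upwards [hnn, hle1] with x hx h1
    have := hle x
    rw [abs_of_nonneg (le_min (hx i) (by linarith))] at this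
    exact le_min_iff.1 this
  refine ⟨fun k => (hf.meas k).add (hm.const_mul _), fun k => (hf.int k).add (hi.const_mul _),
    ?_, ?_, ?_⟩
  · intro k
    filter_upwards [hnn, hbd] with x hx hb
    have h1 := abs_le.1 hb.1
    by_cases hki : k = i
    · subst hki; rw [hpi]; linarith
    · rw [hpk k hki]; linarith [hx k]
  · intro k
    filter_upwards [hf.supp k, hbd] with x hx hb hxR
    have h0 := hx hxR
    by_cases hki : k = i
    · subst hki
      rw [h0] at hb ⊢
      simp [abs_nonpos_iff.1 hb.1]
    · rw [hpk k hki, h0]; simp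
  · intro F
    filter_upwards [hnn, hbd, hdis, hf.sum F] with x hx hb hd hs
    by_cases h0 : f i x = 0
    · have hh : h x = 0 := by
        rw [h0] at hb; exact abs_nonpos_iff.1 hb.1
      simpa [hh] using hs
    · have hz : ∀ k, k ≠ i → f k x = 0 := by
        intro k hk
        have := hd k hk.symm
        rcases min_choice (f i x) (f k x) with h' | h'
        · rw [h'] at this; exact absurd this h0
        · rw [h'] at this; exact this
      have h2 := abs_le.1 hb.2
      by_cases hiF : i ∈ F
      · rw [Finset.sum_eq_single i]
        · rw [hpi]; linarith
        · intro k _ hk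
          rw [hz k hk, hpk k hk]; simp
        · exact fun h => absurd hiF h
      · rw [Finset.sum_eq_zero]
        · exact zero_le_one
        · intro k hk
          have hk : k ≠ i := fun h => hiF (h ▸ hk)
          rw [hz k hk, hpk k hk]; simp

theorem carleson_sparse_general [Countable ι] [SigmaFinite μ] (hR : ∀ i, MeasurableSet (R i))
    (hRf : ∀ i, μ (R i) ≠ ∞) (a : ι → ℝ)
    (ha : ∀ s : Finset ι, ∑ i ∈ s, a i ≤ μ.real (⋃ i ∈ s, R i))
    (hsplit : ∀ B, MeasurableSet B → μ B ≠ 0 →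
      ∃ B₁ ⊆ B, MeasurableSet B₁ ∧ μ B₁ ≠ 0 ∧ μ (B \ B₁) ≠ 0) :
    ∃ E : ι → Set X, (∀ i, MeasurableSet (E i)) ∧ (∀ i, E i ⊆ R i) ∧
      Pairwise (Function.onFun Disjoint E) ∧ ∀ i, a i ≤ μ.real (E i) := by
  obtain ⟨n, hn⟩ := exists_extreme hR hRf a ha
  obtain ⟨f, hf, rfl⟩ := hn.1.1.exists_dens hR hRf
  have h01 := extreme_zero_one hR hsplit hf hn
  have hdis := extreme_disjoint hR hsplit hf hn
  let D : ι → Set X := fun i => {x | f i x = 1} ∩ R i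
  have hD : ∀ i, MeasurableSet (D i) := fun i =>
    (hf.meas i (measurableSet_singleton 1)).inter (hR i)
  have hfD : ∀ i, f i =ᵐ[μ] (D i).indicator (fun _ => (1 : ℝ)) := by
    intro i
    filter_upwards [h01 i, hf.supp i] with x hx hs
    by_cases hxD : x ∈ D i
    · rw [indicator_of_mem hxD]; exact hxD.1
    · rw [indicator_of_notMem hxD]
      by_cases hxR : x ∈ R i
      · rcases min_choice (f i x) (1 - f i x) with h' | h'
        · rw [h'] at hx; exact hx
        · rw [h'] at hx
          exact absurd ⟨show f i x = 1 by linarith, hxR⟩ hxD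
      · exact hs hxR
  refine ⟨fun i => D i \ ⋃ j ∈ {j | j ≠ i}, D j, ?_, ?_, ?_, ?_⟩
  · intro i
    exact (hD i).diff (MeasurableSet.biUnion (Set.to_countable _) fun j _ => hD j)
  · exact fun i x hx => hx.1.2
  · intro i j hij
    rw [Function.onFun, Set.disjoint_left]
    intro x hx hy
    exact hy.2 (mem_biUnion (show i ∈ {k | k ≠ j} from hij) hx.1)
  · intro i
    have h1 := hn.1.2 i
    have h2 : densFun μ f i univ = μ.real (D i) := by
      simp only [densFun, MeasurableSet.univ, if_true, setIntegral_univ]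
      rw [integral_congr_ae (hfD i), integral_indicator (hD i)]
      simp
    have h3 : (D i \ ⋃ j ∈ {j | j ≠ i}, D j : Set X) =ᵐ[μ] D i := by
      have : ∀ᵐ x ∂μ, ∀ j, i ≠ j → min (f i x) (f j x) = 0 := by
        rw [ae_all_iff]
        intro k
        by_cases hk : i = k
        · exact Filter.Eventually.of_forall fun x h => absurd hk h
        · exact (hdis i k hk).mono fun x hx _ => hx
      rw [Filter.eventuallyEq_set]
      filter_upwards [this] with x hx
      refine ⟨fun h => h.1, fun h => ⟨h, ?_⟩⟩
      intro hU
      obtain ⟨j, hj, hxj⟩ := mem_iUnion₂.1 hU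
      have := hx j (Ne.symm hj)
      rw [show f i x = 1 from h.1, show f j x = 1 from hxj.1] at this
      norm_num at this
    rw [measureReal_def, measure_congr h3, ← measureReal_def, ← h2]
    exact h1

end
lemma split_volume (B : Set (ℝ × ℝ)) (hB : MeasurableSet B) (h0 : volume B ≠ 0) :
    ∃ B₁ ⊆ B, MeasurableSet B₁ ∧ volume B₁ ≠ 0 ∧ volume (B \ B₁) ≠ 0 := by
  obtain ⟨x, hx, hpos⟩ := exists_mem_forall_mem_nhdsWithin_pos_measure h0
  have hlt : volume ({x} : Set (ℝ × ℝ)) < volume B := by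
    rw [measure_singleton]; exact pos_iff_ne_zero.2 h0
  obtain ⟨U, hxU, hU, hUB⟩ := Set.exists_isOpen_lt_of_lt {x} _ hlt
  refine ⟨B ∩ U, inter_subset_left, hB.inter hU.measurableSet, ?_, ?_⟩
  · exact (hpos _ (Filter.inter_mem self_mem_nhdsWithin
      (mem_nhdsWithin_of_mem_nhds (hU.mem_nhds (hxU rfl))))).ne'
  · intro h
    have h1 : volume B ≤ volume (B ∩ U) + volume (B \ (B ∩ U)) := by
      conv_lhs => rw [← Set.union_sdiff_cancel (inter_subset_left : B ∩ U ⊆ B)]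
      exact measure_union_le _ _
    rw [h, add_zero] at h1
    exact absurd (h1.trans (measure_mono inter_subset_right)) (not_le.2 hUB)

lemma countable_dyadic : Countable {R : Set (ℝ × ℝ) // IsDyadicRectangle R} := by
  have h : {R : Set (ℝ × ℝ) | IsDyadicRectangle R} ⊆ Set.range (fun q : (ℤ × ℤ) × (ℤ × ℤ) =>
      (Set.Ico ((2 : ℝ) ^ (-q.1.1) * (q.1.2 : ℝ)) ((2 : ℝ) ^ (-q.1.1) * ((q.1.2 : ℝ) + 1))) ×ˢ
      (Set.Ico ((2 : ℝ) ^ (-q.2.1) * (q.2.2 : ℝ)) ((2 : ℝ) ^ (-q.2.1) * ((q.2.2 : ℝ) + 1)))) := by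
    rintro _ ⟨_, _, ⟨k, m, rfl⟩, ⟨k', m', rfl⟩, rfl⟩
    exact ⟨((k, m), (k', m')), rfl⟩
  exact ((Set.countable_range _).mono h).to_subtype

lemma dyadic_measurable {R : Set (ℝ × ℝ)} (h : IsDyadicRectangle R) : MeasurableSet R := by
  obtain ⟨_, _, ⟨k, m, rfl⟩, ⟨k', m', rfl⟩, rfl⟩ := h
  exact measurableSet_Ico.prod measurableSet_Ico

lemma dyadic_finite {R : Set (ℝ × ℝ)} (h : IsDyadicRectangle R) : volume R ≠ ∞ := by
  obtain ⟨_, _, ⟨k, m, rfl⟩, ⟨k', m', rfl⟩, rfl⟩ := h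
  rw [Measure.volume_eq_prod, Measure.prod_prod, Real.volume_Ico, Real.volume_Ico]
  exact ENNReal.mul_ne_top ENNReal.ofReal_ne_top ENNReal.ofReal_ne_top

/-- For Lebesgue measure on `ℝ²` and a family of non-negative
coefficients over the dyadic rectangles satisfying the Carleson condition with constant
`C ≥ 1` over arbitrary subcollections, the family is sparse with constant `C`. -/
theorem dyadic_rectangle_carleson_implies_sparse
    (C : ℝ≥0) (hC : 1 ≤ C)
    (lam : {R : Set (ℝ × ℝ) // IsDyadicRectangle R} → ℝ≥0)
    (hCarleson : ∀ T : Set {R : Set (ℝ × ℝ) // IsDyadicRectangle R},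
      ∑' R : T, (lam R : ℝ≥0∞) ≤ (C : ℝ≥0∞) * volume (⋃ R ∈ T, R.1)) :
    ∃ E : {R : Set (ℝ × ℝ) // IsDyadicRectangle R} → Set (ℝ × ℝ),
      (∀ R, MeasurableSet (E R)) ∧ (∀ R, E R ⊆ R.1) ∧
      Pairwise (Function.onFun Disjoint E) ∧
      ∀ R, (lam R : ℝ≥0∞) ≤ (C : ℝ≥0∞) * volume (E R) := by
  have := countable_dyadic
  have hC0 : (0 : ℝ) < C := lt_of_lt_of_le zero_lt_one (by exact_mod_cast hC)
  obtain ⟨E, hm, hsub, hd, ha⟩ := carleson_sparse_general (μ := (volume : Measure (ℝ × ℝ)))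
    (R := fun R : {R : Set (ℝ × ℝ) // IsDyadicRectangle R} => R.1)
    (fun R => dyadic_measurable R.2) (fun R => dyadic_finite R.2)
    (fun R => (lam R : ℝ) / C) (by
      intro s
      have h := hCarleson (s : Set _)
      have hfin : volume (⋃ R ∈ s, R.1) ≠ ∞ := by
        refine ((measure_biUnion_finset_le s _).trans_lt ?_).ne
        exact ENNReal.sum_lt_top.2 fun R _ => (dyadic_finite R.2).lt_top
      rw [Finset.tsum_subtype' s (fun R => (lam R : ℝ≥0∞))] at h
      simp only [Finset.mem_coe] at h
      have h2 := ENNReal.toReal_mono (ENNReal.mul_ne_top ENNReal.coe_ne_top hfin) h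
      rw [ENNReal.toReal_sum (fun _ _ => ENNReal.coe_ne_top), ENNReal.toReal_mul] at h2
      simp only [ENNReal.coe_toReal] at h2
      rw [← Finset.sum_div, div_le_iff₀ hC0, mul_comm]
      exact h2) split_volume
  refine ⟨E, hm, hsub, hd, fun R => ?_⟩
  have h := ha R
  have hfin : volume (E R) ≠ ∞ := measure_ne_top_of_subset (hsub R) (dyadic_finite R.2)
  rw [div_le_iff₀ hC0, mul_comm] at h
  rw [← ENNReal.toReal_le_toReal ENNReal.coe_ne_top
    (ENNReal.mul_ne_top ENNReal.coe_ne_top hfin), ENNReal.toReal_mul]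
  simpa [measureReal_def] using h
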